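/- arXiv:2304.08903 — 2 statements merged into one kernel-verified Lean document; each statement's English description precedes it below -/
import Mathlib

section
/- With U(u) = {x ∈ [0,1] : ψ(x) > u}, one has lim_{u→∞} Leb(U(u) ∩ ⋂_{j=1}^{3} f^{−j}(U(u)ᶜ)) / Leb(U(u)) = 3/4. (The extremal index of the process X_n = ψ ∘ fⁿ, computed with the cluster-splitting parameter q_n ≡ 3, equals ϑ = 3/4.) -/
open MeasureTheory Filter Set

/-- The doubling map `f(x) = 2x mod 1`. -/
noncomputable def fD : ℝ → ℝ := fun x => Int.fract (2 * x)

/-- `ξ₁ = ζ = √2/16`. -/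
noncomputable def xi1 : ℝ := Real.sqrt 2 / 16
/-- `ξ₂ = f(ζ) = √2/8`. -/
noncomputable def xi2 : ℝ := Real.sqrt 2 / 8
/-- `ξ₃ = f³(ζ) = √2/2`. -/
noncomputable def xi3 : ℝ := Real.sqrt 2 / 2

/-- The punctured ball `{y | 0 < |y - c| < r}`. -/
def puncturedBall (c r : ℝ) : Set ℝ := Metric.ball c r \ {c}

/-- The half-open annulus `{y | a ≤ |y - c| < b}`. -/
def annulus (c a b : ℝ) : Set ℝ := Metric.ball c b \ Metric.ball c a

lemma mem_puncturedBall {c r y : ℝ} :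
    y ∈ puncturedBall c r ↔ (c - r < y ∧ y < c + r) ∧ y ≠ c := by
  rw [puncturedBall, Real.ball_eq_Ioo]; rfl

lemma mem_annulus {c a b y : ℝ} :
    y ∈ annulus c a b ↔ (c - b < y ∧ y < c + b) ∧ ¬ (c - a < y ∧ y < c + a) := by
  rw [annulus, Real.ball_eq_Ioo, Real.ball_eq_Ioo]; rfl

lemma measurableSet_puncturedBall (c r : ℝ) : MeasurableSet (puncturedBall c r) :=
  measurableSet_ball.diff (measurableSet_singleton c)

lemma measurableSet_annulus (c a b : ℝ) : MeasurableSet (annulus c a b) :=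
  measurableSet_ball.diff measurableSet_ball

lemma volume_puncturedBall (c r : ℝ) : volume (puncturedBall c r) = ENNReal.ofReal (2 * r) := by
  rw [puncturedBall, measure_sdiff_null (measure_singleton c), Real.volume_ball]

lemma volume_annulus (c : ℝ) {a b : ℝ} (ha : 0 ≤ a) (hab : a ≤ b) :
    volume (annulus c a b) = ENNReal.ofReal (2 * b - 2 * a) := by
  rw [annulus, measure_sdiff (Metric.ball_subset_ball hab) measurableSet_ball.nullMeasurableSet
    measure_ball_lt_top.ne, Real.volume_ball, Real.volume_ball, ENNReal.ofReal_sub _ (by linarith)]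

lemma lt_abs_zpow_neg_two_iff {r d : ℝ} (hr : 0 < r) :
    |d| ^ (-2 : ℤ) > (r ^ 2)⁻¹ ↔ |d| < r ∧ d ≠ 0 := by
  have hz : |d| ^ (-2 : ℤ) = (|d| ^ 2)⁻¹ := by
    rw [zpow_neg]; rfl
  rw [hz]
  rcases eq_or_ne d 0 with rfl | hd
  · simp [sq_nonneg]
  · have hd' : 0 < |d| := abs_pos.2 hd
    rw [gt_iff_lt, inv_lt_inv₀ (by positivity) (by positivity),
      pow_lt_pow_iff_left₀ hd'.le hr.le two_ne_zero]
    simp [hd]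

lemma lt_observable_iff {c ε r x : ℝ} {ψ : ℝ → ℝ} (hr : 0 < r) (hx : x ∈ Metric.ball c ε)
    (hψ : ∀ x ∈ Metric.ball c ε, ψ x = |x - c| ^ (-2 : ℤ)) :
    ψ x > (r ^ 2)⁻¹ ↔ x ∈ puncturedBall c r := by
  rw [hψ x hx, lt_abs_zpow_neg_two_iff hr, puncturedBall, Set.mem_sdiff, Metric.mem_ball,
    Real.dist_eq, mem_singleton_iff, sub_ne_zero]

lemma fD_eq_of_mem {x : ℝ} (n : ℤ) (h₀ : (n : ℝ) ≤ 2 * x) (h₁ : 2 * x < n + 1) :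
    fD x = 2 * x - n := by
  rw [fD, Int.fract, Int.floor_eq_iff.2 ⟨h₀, h₁⟩]

/-- The exceedance set at level `r⁻²`: punctured balls about the three singularities. -/
def exceedance (r : ℝ) : Set ℝ := puncturedBall xi1 r ∪ puncturedBall xi2 r ∪ puncturedBall xi3 r

lemma mem_exceedance {r y : ℝ} : y ∈ exceedance r ↔
    (((xi1 - r < y ∧ y < xi1 + r) ∧ y ≠ xi1) ∨ ((xi2 - r < y ∧ y < xi2 + r) ∧ y ≠ xi2)) ∨
      ((xi3 - r < y ∧ y < xi3 + r) ∧ y ≠ xi3) := by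
  simp only [exceedance, mem_union, mem_puncturedBall]

lemma mem_escape_iff {U : Set ℝ} {x : ℝ} :
    x ∈ U ∩ ⋂ j ∈ Finset.Icc 1 3, fD^[j] ⁻¹' Uᶜ ↔
      x ∈ U ∧ fD x ∉ U ∧ fD (fD x) ∉ U ∧ fD (fD (fD x)) ∉ U := by
  have h : ∀ p : ℕ → Prop, (∀ j ∈ Finset.Icc 1 3, p j) ↔ p 1 ∧ p 2 ∧ p 3 := by
    intro p
    simp only [show Finset.Icc 1 3 = {1, 2, 3} from rfl, Finset.forall_mem_insert,
      Finset.mem_singleton, forall_eq]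
  simp only [mem_inter_iff, mem_iInter₂, h, mem_preimage, mem_compl_iff]
  rfl

lemma sqrt_two_bounds : (1.414 : ℝ) < √2 ∧ √2 < 1.4143 :=
  ⟨Real.lt_sqrt_of_sq_lt (by norm_num), (Real.sqrt_lt' (by norm_num)).2 (by norm_num)⟩

lemma escape_xi1 {r x : ℝ} (hr : 0 < r) (hr' : r < 1 / 1000) (hx : x ∈ puncturedBall xi1 r) :
    (fD x ∉ exceedance r ∧ fD (fD x) ∉ exceedance r ∧ fD (fD (fD x)) ∉ exceedance r) ↔
      x ∈ annulus xi1 (r / 2) r := by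
  obtain ⟨hs, hs'⟩ := sqrt_two_bounds
  simp only [mem_puncturedBall, mem_annulus, mem_exceedance, xi1, xi2, xi3] at hx ⊢
  obtain ⟨⟨hx₁, hx₂⟩, hx₃⟩ := hx
  have e₁ : fD x = 2 * x := by
    simpa using fD_eq_of_mem (x := x) 0 (by push_cast; linarith) (by push_cast; linarith)
  have e₂ : fD (2 * x) = 4 * x := by
    rw [fD_eq_of_mem (x := 2 * x) 0 (by push_cast; linarith) (by push_cast; linarith)]
    push_cast; ring
  have e₃ : fD (4 * x) = 8 * x := by
    rw [fD_eq_of_mem (x := 4 * x) 0 (by push_cast; linarith) (by push_cast; linarith)]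
    push_cast; ring
  rw [e₁, e₂, e₃]
  constructor
  · rintro ⟨h, -, -⟩
    refine ⟨⟨hx₁, hx₂⟩, fun ⟨ha, hb⟩ => h (Or.inl (Or.inr ⟨⟨by linarith, by linarith⟩, ?_⟩))⟩
    exact fun hc => hx₃ (by linarith)
  · rintro ⟨-, h⟩
    refine ⟨?_, ?_, ?_⟩
    · rintro ((⟨⟨_, _⟩, _⟩ | ⟨⟨_, _⟩, _⟩) | ⟨⟨_, _⟩, _⟩)
      · linarith
      · exact h ⟨by linarith, by linarith⟩
      · linarith
    · rintro ((⟨⟨_, _⟩, _⟩ | ⟨⟨_, _⟩, _⟩) | ⟨⟨_, _⟩, _⟩) <;> linarith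
    · rintro ((⟨⟨_, _⟩, _⟩ | ⟨⟨_, _⟩, _⟩) | ⟨⟨_, _⟩, _⟩)
      · linarith
      · linarith
      · exact h ⟨by linarith, by linarith⟩

lemma escape_xi2 {r x : ℝ} (hr : 0 < r) (hr' : r < 1 / 1000) (hx : x ∈ puncturedBall xi2 r) :
    (fD x ∉ exceedance r ∧ fD (fD x) ∉ exceedance r ∧ fD (fD (fD x)) ∉ exceedance r) ↔
      x ∈ annulus xi2 (r / 4) r := by
  obtain ⟨hs, hs'⟩ := sqrt_two_bounds
  simp only [mem_puncturedBall, mem_annulus, mem_exceedance, xi1, xi2, xi3] at hx ⊢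
  obtain ⟨⟨hx₁, hx₂⟩, hx₃⟩ := hx
  have e₁ : fD x = 2 * x := by
    simpa using fD_eq_of_mem (x := x) 0 (by push_cast; linarith) (by push_cast; linarith)
  have e₂ : fD (2 * x) = 4 * x := by
    rw [fD_eq_of_mem (x := 2 * x) 0 (by push_cast; linarith) (by push_cast; linarith)]
    push_cast; ring
  have e₃ : fD (4 * x) = 8 * x - 1 := by
    rw [fD_eq_of_mem (x := 4 * x) 1 (by push_cast; linarith) (by push_cast; linarith)]
    push_cast; ring
  rw [e₁, e₂, e₃]
  constructor
  · rintro ⟨-, h, -⟩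
    refine ⟨⟨hx₁, hx₂⟩, fun ⟨ha, hb⟩ => h (Or.inr ⟨⟨by linarith, by linarith⟩, ?_⟩)⟩
    exact fun hc => hx₃ (by linarith)
  · rintro ⟨-, h⟩
    refine ⟨?_, ?_, ?_⟩
    · rintro ((⟨⟨_, _⟩, _⟩ | ⟨⟨_, _⟩, _⟩) | ⟨⟨_, _⟩, _⟩) <;> linarith
    · rintro ((⟨⟨_, _⟩, _⟩ | ⟨⟨_, _⟩, _⟩) | ⟨⟨_, _⟩, _⟩)
      · linarith
      · linarith
      · exact h ⟨by linarith, by linarith⟩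
    · rintro ((⟨⟨_, _⟩, _⟩ | ⟨⟨_, _⟩, _⟩) | ⟨⟨_, _⟩, _⟩) <;> linarith

lemma escape_xi3 {r x : ℝ} (hr' : r < 1 / 1000) (hx : x ∈ puncturedBall xi3 r) :
    fD x ∉ exceedance r ∧ fD (fD x) ∉ exceedance r ∧ fD (fD (fD x)) ∉ exceedance r := by
  obtain ⟨hs, hs'⟩ := sqrt_two_bounds
  simp only [mem_puncturedBall, mem_exceedance, xi1, xi2, xi3] at hx ⊢
  obtain ⟨⟨hx₁, hx₂⟩, -⟩ := hx
  have e₁ : fD x = 2 * x - 1 := by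
    simpa using fD_eq_of_mem (x := x) 1 (by push_cast; linarith) (by push_cast; linarith)
  have e₂ : fD (2 * x - 1) = 4 * x - 2 := by
    rw [fD_eq_of_mem (x := 2 * x - 1) 0 (by push_cast; linarith) (by push_cast; linarith)]
    push_cast; ring
  have e₃ : fD (4 * x - 2) = 8 * x - 5 := by
    rw [fD_eq_of_mem (x := 4 * x - 2) 1 (by push_cast; linarith) (by push_cast; linarith)]
    push_cast; ring
  rw [e₁, e₂, e₃]
  refine ⟨?_, ?_, ?_⟩ <;>
    rintro ((⟨⟨_, _⟩, _⟩ | ⟨⟨_, _⟩, _⟩) | ⟨⟨_, _⟩, _⟩) <;> linarith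

lemma annulus_subset_puncturedBall (c : ℝ) {a b : ℝ} (ha : 0 < a) :
    annulus c a b ⊆ puncturedBall c b :=
  sdiff_subset_sdiff_right (singleton_subset_iff.2 (Metric.mem_ball_self ha))

lemma escape_eq {r : ℝ} (hr : 0 < r) (hr' : r < 1 / 1000) :
    (exceedance r ∩ ⋂ j ∈ Finset.Icc 1 3, fD^[j] ⁻¹' (exceedance r)ᶜ) =
      annulus xi1 (r / 2) r ∪ annulus xi2 (r / 4) r ∪ puncturedBall xi3 r := by
  ext x
  rw [mem_escape_iff]
  constructor
  · rintro ⟨(hx | hx) | hx, h⟩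
    · exact Or.inl (Or.inl ((escape_xi1 hr hr' hx).1 h))
    · exact Or.inl (Or.inr ((escape_xi2 hr hr' hx).1 h))
    · exact Or.inr hx
  · rintro ((hx | hx) | hx)
    · have hx' := annulus_subset_puncturedBall _ (by positivity) hx
      exact ⟨Or.inl (Or.inl hx'), (escape_xi1 hr hr' hx').2 hx⟩
    · have hx' := annulus_subset_puncturedBall _ (by positivity) hx
      exact ⟨Or.inl (Or.inr hx'), (escape_xi2 hr hr' hx').2 hx⟩
    · exact ⟨Or.inr hx, escape_xi3 hr' hx⟩

lemma disjoint_puncturedBall {c c' r : ℝ} (h : c + r ≤ c' - r) :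
    Disjoint (puncturedBall c r) (puncturedBall c' r) := by
  rw [Set.disjoint_left]
  intro x hx hx'
  rw [mem_puncturedBall] at hx hx'
  linarith [hx.1.2, hx'.1.1]

lemma disjoint_puncturedBall_xi {r : ℝ} (hr' : r < 1 / 1000) :
    Disjoint (puncturedBall xi1 r) (puncturedBall xi2 r) ∧
      Disjoint (puncturedBall xi1 r) (puncturedBall xi3 r) ∧
      Disjoint (puncturedBall xi2 r) (puncturedBall xi3 r) := by
  obtain ⟨hs, hs'⟩ := sqrt_two_bounds
  refine ⟨?_, ?_, ?_⟩ <;> apply disjoint_puncturedBall <;> simp only [xi1, xi2, xi3] <;> linarith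

lemma volume_exceedance {r : ℝ} (hr : 0 < r) (hr' : r < 1 / 1000) :
    volume (exceedance r) = ENNReal.ofReal (6 * r) := by
  obtain ⟨h₁₂, h₁₃, h₂₃⟩ := disjoint_puncturedBall_xi hr'
  rw [exceedance, measure_union (disjoint_union_left.2 ⟨h₁₃, h₂₃⟩)
    (measurableSet_puncturedBall _ _), measure_union h₁₂ (measurableSet_puncturedBall _ _),
    volume_puncturedBall, volume_puncturedBall, volume_puncturedBall,
    ← ENNReal.ofReal_add (by linarith) (by linarith),
    ← ENNReal.ofReal_add (by linarith) (by linarith)]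
  congr 1; ring

lemma volume_escape {r : ℝ} (hr : 0 < r) (hr' : r < 1 / 1000) :
    volume (exceedance r ∩ ⋂ j ∈ Finset.Icc 1 3, fD^[j] ⁻¹' (exceedance r)ᶜ) =
      ENNReal.ofReal (9 / 2 * r) := by
  obtain ⟨h₁₂, h₁₃, h₂₃⟩ := disjoint_puncturedBall_xi hr'
  have s₁ : annulus xi1 (r / 2) r ⊆ _ := annulus_subset_puncturedBall xi1 (by positivity)
  have s₂ : annulus xi2 (r / 4) r ⊆ _ := annulus_subset_puncturedBall xi2 (by positivity)
  rw [escape_eq hr hr', measure_union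
    (disjoint_union_left.2 ⟨h₁₃.mono_left s₁, h₂₃.mono_left s₂⟩) (measurableSet_puncturedBall _ _),
    measure_union (h₁₂.mono s₁ s₂) (measurableSet_annulus _ _ _),
    volume_puncturedBall, volume_annulus _ (by linarith) (by linarith),
    volume_annulus _ (by linarith) (by linarith),
    ← ENNReal.ofReal_add (by linarith) (by linarith),
    ← ENNReal.ofReal_add (by linarith) (by linarith)]
  congr 1; ring

lemma volume_ratio {r : ℝ} (hr : 0 < r) (hr' : r < 1 / 1000) :
    (volume (exceedance r ∩ ⋂ j ∈ Finset.Icc 1 3, fD^[j] ⁻¹' (exceedance r)ᶜ)).toReal /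
      (volume (exceedance r)).toReal = 3 / 4 := by
  rw [volume_escape hr hr', volume_exceedance hr hr', ENNReal.toReal_ofReal (by positivity),
    ENNReal.toReal_ofReal (by positivity)]
  field_simp
  norm_num

/-- with `U(u) = {x ∈ [0,1] : ψ(x) > u}`,
`lim_{u→∞} Leb(U(u) ∩ ⋂_{j=1}^{3} f^{−j}(U(u)ᶜ)) / Leb(U(u)) = 3/4`
(the extremal index with cluster-splitting parameter `qₙ ≡ 3` equals `3/4`). -/
theorem stmt5
    (ε₁ ε₂ ε₃ : ℝ) (hε₁ : 0 < ε₁) (hε₂ : 0 < ε₂) (hε₃ : 0 < ε₃)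
    (hd₁₂ : Disjoint (Metric.ball xi1 ε₁) (Metric.ball xi2 ε₂))
    (hd₁₃ : Disjoint (Metric.ball xi1 ε₁) (Metric.ball xi3 ε₃))
    (hd₂₃ : Disjoint (Metric.ball xi2 ε₂) (Metric.ball xi3 ε₃))
    (hsub : Metric.ball xi1 ε₁ ∪ Metric.ball xi2 ε₂ ∪ Metric.ball xi3 ε₃ ⊆ Ioo (0:ℝ) 1)
    (ψ : ℝ → ℝ)
    (hψ₁ : ∀ x ∈ Metric.ball xi1 ε₁, ψ x = |x - xi1| ^ (-2 : ℤ))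
    (hψ₂ : ∀ x ∈ Metric.ball xi2 ε₂, ψ x = |x - xi2| ^ (-2 : ℤ))
    (hψ₃ : ∀ x ∈ Metric.ball xi3 ε₃, ψ x = |x - xi3| ^ (-2 : ℤ))
    (hψ₀ : ∀ x, x ∉ Metric.ball xi1 ε₁ ∪ Metric.ball xi2 ε₂ ∪ Metric.ball xi3 ε₃ → ψ x = 0) :
    Tendsto
      (fun u : ℝ =>
        (volume ({x ∈ Icc (0:ℝ) 1 | ψ x > u} ∩
            ⋂ j ∈ Finset.Icc 1 3, fD^[j] ⁻¹' ({x ∈ Icc (0:ℝ) 1 | ψ x > u})ᶜ)).toReal /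
          (volume {x ∈ Icc (0:ℝ) 1 | ψ x > u}).toReal)
      atTop (nhds (3/4)) := by
  have hsmall : ∀ δ : ℝ, 0 < δ → ∀ᶠ u : ℝ in atTop, (√u)⁻¹ < δ := fun δ hδ =>
    (tendsto_inv_atTop_zero.comp Real.tendsto_sqrt_atTop).eventually_lt_const hδ
  refine tendsto_const_nhds.congr' ?_
  filter_upwards [eventually_gt_atTop 0, hsmall _ hε₁, hsmall _ hε₂, hsmall _ hε₃,
    hsmall (1 / 1000) (by norm_num)] with u hu h₁ h₂ h₃ hr'
  have hr : 0 < (√u)⁻¹ := inv_pos.2 (Real.sqrt_pos.2 hu)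
  have hur : u = ((√u)⁻¹ ^ 2)⁻¹ := by rw [inv_pow, inv_inv, Real.sq_sqrt hu.le]
  generalize (√u)⁻¹ = r at hr hur h₁ h₂ h₃ hr'
  have hU : {x ∈ Icc (0:ℝ) 1 | ψ x > u} = exceedance r := by
    ext x
    have hsub' : ∀ {c ε : ℝ}, r < ε → x ∈ puncturedBall c r → x ∈ Metric.ball c ε :=
      fun h hx => Metric.ball_subset_ball h.le hx.1
    constructor
    · rintro ⟨-, hx⟩
      by_cases hb : x ∈ Metric.ball xi1 ε₁ ∪ Metric.ball xi2 ε₂ ∪ Metric.ball xi3 ε₃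
      · rw [hur] at hx
        rcases hb with (hb | hb) | hb
        · exact Or.inl (Or.inl ((lt_observable_iff hr hb hψ₁).1 hx))
        · exact Or.inl (Or.inr ((lt_observable_iff hr hb hψ₂).1 hx))
        · exact Or.inr ((lt_observable_iff hr hb hψ₃).1 hx)
      · rw [hψ₀ x hb] at hx
        exact absurd hx hu.le.not_gt
    · rw [hur]
      rintro ((hx | hx) | hx)
      · have hb := hsub' h₁ hx
        exact ⟨Ioo_subset_Icc_self (hsub (Or.inl (Or.inl hb))), (lt_observable_iff hr hb hψ₁).2 hx⟩
      · have hb := hsub' h₂ hx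
        exact ⟨Ioo_subset_Icc_self (hsub (Or.inl (Or.inr hb))), (lt_observable_iff hr hb hψ₂).2 hx⟩
      · have hb := hsub' h₃ hx
        exact ⟨Ioo_subset_Icc_self (hsub (Or.inr hb)), (lt_observable_iff hr hb hψ₃).2 hx⟩
  rw [hU, volume_ratio hr hr']
end

section
/- With U(u) = {p ∈ [0,1]² : ‖Ψ(p)‖ > u}, one has lim_{u→∞} Leb(U(u) ∩ f^{−1}(U(u)ᶜ)) / Leb(U(u)) = 16/17. (The extremal index of X_n = Ψ ∘ fⁿ, computed with the cluster-splitting parameter q_n ≡ 1, equals ϑ = 16/17.) -/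
open MeasureTheory Filter Set
open scoped ENNReal

/-- The map `f(x,y) = (2x mod 1, 3y mod 1)` on the plane. -/
noncomputable def f2 : EuclideanSpace ℝ (Fin 2) → EuclideanSpace ℝ (Fin 2) :=
  fun p => (WithLp.equiv 2 (Fin 2 → ℝ)).symm ![Int.fract (2 * p 0), Int.fract (3 * p 1)]

/-- `ζ = (1/√2, 1/√2)`. -/
noncomputable def zeta2 : EuclideanSpace ℝ (Fin 2) :=
  (WithLp.equiv 2 (Fin 2 → ℝ)).symm ![1 / Real.sqrt 2, 1 / Real.sqrt 2]

lemma mem_ball_iff_sq_add_sq_lt (p c : EuclideanSpace ℝ (Fin 2)) {r : ℝ} (hr : 0 < r) :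
    p ∈ Metric.ball c r ↔ (p 0 - c 0) ^ 2 + (p 1 - c 1) ^ 2 < r ^ 2 := by
  rw [Metric.mem_ball, EuclideanSpace.dist_eq, Real.sqrt_lt' hr, Fin.sum_univ_two,
    Real.dist_eq, Real.dist_eq, sq_abs, sq_abs]

lemma f2_apply_zero (p : EuclideanSpace ℝ (Fin 2)) : f2 p 0 = Int.fract (2 * p 0) := rfl

lemma f2_apply_one (p : EuclideanSpace ℝ (Fin 2)) : f2 p 1 = Int.fract (3 * p 1) := rfl

lemma fract_eq_sub_intCast {x : ℝ} {n : ℤ} (h0 : n ≤ x) (h1 : x < n + 1) :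
    Int.fract x = x - n :=
  Int.fract_eq_iff.2 ⟨by linarith, by linarith, n, by ring⟩

lemma exists_zeta2_eq :
    ∃ s : ℝ, 0.707 < s ∧ s < 0.7072 ∧ zeta2 0 = s ∧ zeta2 1 = s := by
  refine ⟨1 / √2, ?_, ?_, rfl, rfl⟩
  · rw [lt_div_iff₀ (by positivity)]
    have : √2 < 1.41422 := (Real.sqrt_lt' (by norm_num)).2 (by norm_num)
    linarith
  · rw [div_lt_iff₀ (by positivity)]
    have : 1.41421 < √2 := Real.lt_sqrt_of_sq_lt (by norm_num)
    linarith

lemma f2_mem_ball_of_mem_ball_zeta2 {p : EuclideanSpace ℝ (Fin 2)} {r : ℝ} (hr : 0 < r)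
    (hr' : r < 1 / 1000) (hp : p ∈ Metric.ball zeta2 r) :
    f2 p ∈ Metric.ball (f2 zeta2) (4 * r) := by
  obtain ⟨s, h1, h2, hs0, hs1⟩ := exists_zeta2_eq
  rw [mem_ball_iff_sq_add_sq_lt _ _ hr, hs0, hs1] at hp
  have ha := abs_lt.1 (abs_lt_of_sq_lt_sq (a := p 0 - s) (by nlinarith) hr.le)
  have hb := abs_lt.1 (abs_lt_of_sq_lt_sq (a := p 1 - s) (by nlinarith) hr.le)
  rw [mem_ball_iff_sq_add_sq_lt _ _ (by positivity)]
  simp only [f2_apply_zero, f2_apply_one, hs0, hs1]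
  rw [fract_eq_sub_intCast (x := 2 * p 0) (n := 1) (by push_cast; linarith)
      (by push_cast; linarith),
    fract_eq_sub_intCast (x := 3 * p 1) (n := 2) (by push_cast; linarith)
      (by push_cast; linarith),
    fract_eq_sub_intCast (x := 2 * s) (n := 1) (by push_cast; linarith)
      (by push_cast; linarith),
    fract_eq_sub_intCast (x := 3 * s) (n := 2) (by push_cast; linarith)
      (by push_cast; linarith)]
  nlinarith [sq_nonneg (p 0 - s), sq_nonneg (p 1 - s)]

lemma f2_notMem_of_mem_ball_f2_zeta2 {p : EuclideanSpace ℝ (Fin 2)} {r : ℝ} (hr : 0 < r)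
    (hr' : r < 1 / 1000) (hp : p ∈ Metric.ball (f2 zeta2) (4 * r)) :
    f2 p ∉ Metric.ball zeta2 r ∪ Metric.ball (f2 zeta2) (4 * r) := by
  obtain ⟨s, h1, h2, hs0, hs1⟩ := exists_zeta2_eq
  have hr4 : 0 < 4 * r := by positivity
  have hf0 : f2 zeta2 0 = 2 * s - 1 := by
    rw [f2_apply_zero, hs0, fract_eq_sub_intCast (n := 1) (by push_cast; linarith)
      (by push_cast; linarith)]
    simp
  rw [mem_ball_iff_sq_add_sq_lt _ _ hr4, hf0] at hp
  have ha := abs_lt.1 (abs_lt_of_sq_lt_sq (a := p 0 - (2 * s - 1)) (by nlinarith) hr4.le)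
  have hfp : f2 p 0 = 2 * p 0 := by
    rw [f2_apply_zero, fract_eq_sub_intCast (n := 0) (by push_cast; linarith)
      (by push_cast; linarith)]
    simp
  rintro (h | h)
  · rw [mem_ball_iff_sq_add_sq_lt _ _ hr, hs0, hfp] at h
    have hb := abs_lt.1 (abs_lt_of_sq_lt_sq (a := 2 * p 0 - s) (by nlinarith) hr.le)
    linarith
  · rw [mem_ball_iff_sq_add_sq_lt _ _ hr4, hf0, hfp] at h
    have hb := abs_lt.1 (abs_lt_of_sq_lt_sq (a := 2 * p 0 - (2 * s - 1)) (by nlinarith) hr4.le)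
    linarith

lemma ofReal_inv_pow_four_lt_iff {a r : ℝ} (ha : 0 ≤ a) (hr : 0 < r) :
    ENNReal.ofReal ((r ^ 4)⁻¹) < (ENNReal.ofReal a ^ 4)⁻¹ ↔ a < r := by
  rw [ENNReal.ofReal_inv_of_pos (by positivity), ENNReal.inv_lt_inv, ← ENNReal.ofReal_pow ha,
    ENNReal.ofReal_lt_ofReal_iff (by positivity), pow_lt_pow_iff_left₀ ha hr.le (by norm_num)]

lemma mul_inv_ofReal_pow_four (a : ℝ) :
    256 * (ENNReal.ofReal a ^ 4)⁻¹ = (ENNReal.ofReal (a / 4) ^ 4)⁻¹ := by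
  have h4 : (4 : ℝ≥0∞) ^ 4 = 256 := by norm_num
  rw [ENNReal.ofReal_div_of_pos (by norm_num), ENNReal.ofReal_ofNat, ENNReal.div_eq_inv_mul,
    mul_pow, ENNReal.mul_inv (Or.inl (by simp)) (Or.inl (by simp)), ← ENNReal.inv_pow, inv_inv, h4]

lemma setOf_ofReal_lt_eq_union_ball {ε₁ ε₂ r : ℝ} (hr : 0 < r) (hr₁ : r ≤ ε₁) (hr₂ : 4 * r ≤ ε₂)
    {c d : EuclideanSpace ℝ (Fin 2)} {Φ : EuclideanSpace ℝ (Fin 2) → ℝ≥0∞}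
    (hΦ₁ : ∀ p ∈ Metric.ball c ε₁, Φ p = (ENNReal.ofReal ‖p - c‖ ^ 4)⁻¹)
    (hΦ₂ : ∀ p ∈ Metric.ball d ε₂, Φ p = 256 * (ENNReal.ofReal ‖p - d‖ ^ 4)⁻¹)
    (hΦ₀ : ∀ p, p ∉ Metric.ball c ε₁ ∪ Metric.ball d ε₂ → Φ p = 0) :
    {p | Φ p > ENNReal.ofReal ((r ^ 4)⁻¹)} = Metric.ball c r ∪ Metric.ball d (4 * r) := by
  have key₁ : ∀ p ∈ Metric.ball c ε₁,
      (Φ p > ENNReal.ofReal ((r ^ 4)⁻¹) ↔ p ∈ Metric.ball c r) := fun p hp => by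
    rw [hΦ₁ p hp, gt_iff_lt, ofReal_inv_pow_four_lt_iff (norm_nonneg _) hr, mem_ball_iff_norm]
  have key₂ : ∀ p ∈ Metric.ball d ε₂,
      (Φ p > ENNReal.ofReal ((r ^ 4)⁻¹) ↔ p ∈ Metric.ball d (4 * r)) := fun p hp => by
    rw [hΦ₂ p hp, gt_iff_lt, mul_inv_ofReal_pow_four,
      ofReal_inv_pow_four_lt_iff (by positivity) hr, mem_ball_iff_norm, div_lt_iff₀' (by norm_num)]
  ext p
  constructor
  · intro hp
    by_cases h : p ∈ Metric.ball c ε₁ ∪ Metric.ball d ε₂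
    · exact h.imp (fun h => (key₁ p h).1 hp) (fun h => (key₂ p h).1 hp)
    · simp [hΦ₀ p h] at hp
  · rintro (h | h)
    · exact (key₁ p (Metric.ball_subset_ball hr₁ h)).2 h
    · exact (key₂ p (Metric.ball_subset_ball hr₂ h)).2 h

lemma toReal_volume_ball_fin_two (c : EuclideanSpace ℝ (Fin 2)) {r : ℝ} (hr : 0 ≤ r) :
    (volume (Metric.ball c r)).toReal = r ^ 2 * Real.pi := by
  rw [EuclideanSpace.volume_ball_fin_two]
  simp [hr, Real.pi_pos.le]

/-- with `U(u) = {p : ‖Ψ(p)‖ > u}`,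
`lim_{u→∞} Leb(U(u) ∩ f^{−1}(U(u)ᶜ)) / Leb(U(u)) = 16/17`
(the extremal index with cluster-splitting parameter `qₙ ≡ 1` equals `16/17`).
The magnitude `‖Ψ(·)‖` is recorded as an `ℝ≥0∞`-valued function `Φ`
(so that `Φ = ∞` at the two maximal points, where `h(0) = +∞`). -/
theorem stmt7
    (ε₁ ε₂ : ℝ) (hε₁ : 0 < ε₁) (hε₂ : 0 < ε₂)
    (hdisj : Disjoint (Metric.ball zeta2 ε₁) (Metric.ball (f2 zeta2) ε₂))
    (hsub : Metric.ball zeta2 ε₁ ∪ Metric.ball (f2 zeta2) ε₂ ⊆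
      {p : EuclideanSpace ℝ (Fin 2) | ∀ i, p i ∈ Ioo (0:ℝ) 1})
    (Φ : EuclideanSpace ℝ (Fin 2) → ℝ≥0∞)
    (hΦ₁ : ∀ p ∈ Metric.ball zeta2 ε₁, Φ p = (ENNReal.ofReal ‖p - zeta2‖ ^ 4)⁻¹)
    (hΦ₂ : ∀ p ∈ Metric.ball (f2 zeta2) ε₂,
      Φ p = 256 * (ENNReal.ofReal ‖p - f2 zeta2‖ ^ 4)⁻¹)
    (hΦ₀ : ∀ p, p ∉ Metric.ball zeta2 ε₁ ∪ Metric.ball (f2 zeta2) ε₂ → Φ p = 0) :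
    Tendsto
      (fun u : ℝ =>
        (volume ({p : EuclideanSpace ℝ (Fin 2) | Φ p > ENNReal.ofReal u} ∩
            f2 ⁻¹' ({p : EuclideanSpace ℝ (Fin 2) | Φ p > ENNReal.ofReal u})ᶜ)).toReal /
          (volume {p : EuclideanSpace ℝ (Fin 2) | Φ p > ENNReal.ofReal u}).toReal)
      atTop (nhds (16/17)) := by
  have hlim : Tendsto (fun u : ℝ => (√(√u))⁻¹) atTop (nhds 0) :=
    tendsto_inv_atTop_zero.comp (Real.tendsto_sqrt_atTop.comp Real.tendsto_sqrt_atTop)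
  have hm : 0 < min (min ε₁ (ε₂ / 4)) (1 / 1000) := by positivity
  refine tendsto_const_nhds.congr' ?_
  filter_upwards [hlim.eventually_lt_const hm, eventually_gt_atTop 0] with u hu hu0
  obtain ⟨r, hr_def⟩ : ∃ r, r = (√(√u))⁻¹ := ⟨_, rfl⟩
  have hr : 0 < r := by rw [hr_def]; positivity
  have hur : u = (r ^ 4)⁻¹ := by
    rw [hr_def, inv_pow, inv_inv, show 4 = 2 * 2 from rfl, pow_mul,
      Real.sq_sqrt (Real.sqrt_nonneg u), Real.sq_sqrt hu0.le]
  rw [← hr_def, lt_min_iff, lt_min_iff] at hu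
  obtain ⟨⟨hr₁, hr₂⟩, hr₃⟩ := hu
  have hr₂' : 4 * r ≤ ε₂ := by linarith
  rw [hur, setOf_ofReal_lt_eq_union_ball hr hr₁.le hr₂' hΦ₁ hΦ₂ hΦ₀]
  have hexit : (Metric.ball zeta2 r ∪ Metric.ball (f2 zeta2) (4 * r)) ∩
      f2 ⁻¹' (Metric.ball zeta2 r ∪ Metric.ball (f2 zeta2) (4 * r))ᶜ =
      Metric.ball (f2 zeta2) (4 * r) := by
    ext p
    refine ⟨?_, fun h => ⟨Or.inr h, f2_notMem_of_mem_ball_f2_zeta2 hr hr₃ h⟩⟩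
    rintro ⟨h | h, hp⟩
    · exact absurd (Or.inr (f2_mem_ball_of_mem_ball_zeta2 hr hr₃ h)) hp
    · exact h
  have hd : Disjoint (Metric.ball zeta2 r) (Metric.ball (f2 zeta2) (4 * r)) :=
    hdisj.mono (Metric.ball_subset_ball hr₁.le) (Metric.ball_subset_ball hr₂')
  rw [hexit, measure_union hd measurableSet_ball,
    ENNReal.toReal_add measure_ball_lt_top.ne measure_ball_lt_top.ne,
    toReal_volume_ball_fin_two _ hr.le, toReal_volume_ball_fin_two _ (by positivity)]
  have := Real.pi_pos
  field_simp
  ring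
end
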